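/- arXiv:2202.07124 — 2 statements merged into one kernel-verified Lean document; each statement's English description precedes it below -/
import Mathlib

section
/- Let (X,ρ,μ) be a quasi-metric measure space, fix α ∈ (0,∞), p ∈ (0,∞), q ∈ (0,∞], and s ∈ (0,α], where s = α is permitted only when q = ∞. Let Ψ ∈ Ċ^α(X,ρ) be bounded and vanish outside a μ-measurable set V ⊂ X. Then for every f ∈ M^s_{p,q}(V,ρ,μ) the product Ψf (extended by 0 outside V) belongs to M^s_{p,q}(X,ρ,μ) and ‖Ψf‖_{M^s_{p,q}(X,ρ,μ)} ≤ C ‖f‖_{M^s_{p,q}(V,ρ,μ)} for some constant C depending on Ψ, s, p, q, α but not on f. The same statement holds with M^s_{p,q} replaced by N^s_{p,q}. -/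
open MeasureTheory ENNReal Set

noncomputable section

namespace HajlaszPaper

variable {X : Type*}

/-- The `ρ`-ball centered at `x` with radius `r`. -/
def qball (ρ : X → X → ℝ) (x : X) (r : ℝ) : Set X := {y | ρ x y < r}

/-- `ρ` is a quasi-metric on `X`. -/
def IsQuasiDist (ρ : X → X → ℝ) : Prop :=
  (∀ x y, 0 ≤ ρ x y) ∧ (∀ x y, ρ x y = 0 ↔ x = y) ∧
    (∃ C₀ : ℝ, 1 ≤ C₀ ∧ ∀ x y, ρ y x ≤ C₀ * ρ x y) ∧
    (∃ C₁ : ℝ, 1 ≤ C₁ ∧ ∀ x y z, ρ x y ≤ C₁ * max (ρ x z) (ρ z y))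

/-- The least admissible quasi-triangle constant `C_ρ`. -/
def Crho (ρ : X → X → ℝ) : ℝ :=
  sInf {C : ℝ | 1 ≤ C ∧ ∀ x y z : X, ρ x y ≤ C * max (ρ x z) (ρ z y)}

/-- The least admissible quasi-symmetry constant `C̃_ρ`. -/
def CrhoTilde (ρ : X → X → ℝ) : ℝ :=
  sInf {C : ℝ | 1 ≤ C ∧ ∀ x y : X, ρ y x ≤ C * ρ x y}

/-- Two quasi-metrics are (bi-Lipschitz, i.e. pointwise) equivalent. -/
def EquivQM (ρ ϱ : X → X → ℝ) : Prop :=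
  ∃ c : ℝ, 1 ≤ c ∧ ∀ x y, c⁻¹ * ϱ x y ≤ ρ x y ∧ ρ x y ≤ c * ϱ x y

variable [MeasurableSpace X]

/-- `(X, ρ, μ)` is a quasi-metric measure space. -/
structure IsQMMS (ρ : X → X → ℝ) (μ : Measure X) : Prop where
  nontrivial : ∃ x y : X, x ≠ y
  quasi : IsQuasiDist ρ
  measurableSet_ball : ∀ (x : X) (r : ℝ), 0 < r → MeasurableSet (qball ρ x r)
  ball_pos : ∀ (x : X) (r : ℝ), 0 < r → 0 < μ (qball ρ x r)
  ball_lt_top : ∀ (x : X) (r : ℝ), 0 < r → μ (qball ρ x r) < ∞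

/-- Every `μ`-measurable set is contained in a Borel (measurable) set of equal measure. -/
def BorelRegular (μ : Measure X) : Prop :=
  ∀ A : Set X, ∃ B : Set X, A ⊆ B ∧ MeasurableSet B ∧ μ A = μ B

/-- `μ` is `Q`-doubling. -/
def QDoubling (ρ : X → X → ℝ) (μ : Measure X) (Q : ℝ) : Prop :=
  ∃ κ : ℝ, 0 < κ ∧ ∀ (x y : X) (r R : ℝ), 0 < r → r ≤ R →
    qball ρ x r ⊆ qball ρ y R →
    ENNReal.ofReal (κ * (r / R) ^ Q) * μ (qball ρ y R) ≤ μ (qball ρ x r)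

/-- `μ` is doubling. -/
def DoublingMeas (ρ : X → X → ℝ) (μ : Measure X) : Prop :=
  ∃ Cd : ℝ, 0 < Cd ∧ ∀ (x : X) (r : ℝ), 0 < r →
    μ (qball ρ x (2 * r)) ≤ ENNReal.ofReal Cd * μ (qball ρ x r)

/-- The measure density condition for `Ω`. -/
def MeasDensity (ρ : X → X → ℝ) (μ : Measure X) (Ω : Set X) : Prop :=
  ∃ c : ℝ, 0 < c ∧ ∀ x ∈ Ω, ∀ r : ℝ, 0 < r → r ≤ 1 →
    μ (qball ρ x r) ≤ ENNReal.ofReal c * μ (qball ρ x r ∩ Ω)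

/-- `Ω` is locally uniformly perfect with constant `lam ∈ (0,1)`. -/
def LocUnifPerfect (ρ : X → X → ℝ) (Ω : Set X) (lam : ℝ) : Prop :=
  ∀ x ∈ Ω, ∀ r : ℝ, 0 < r → r ≤ 1 → (Ω \ qball ρ x r).Nonempty →
    ((qball ρ x r ∩ Ω) \ qball ρ x (lam * r)).Nonempty

/-- The critical radius `φ^x_{Ω,ρ}(r)`. -/
def phiRad (ρ : X → X → ℝ) (μ : Measure X) (Ω : Set X) (x : X) (r : ℝ) : ℝ :=
  sSup {t : ℝ | 0 ≤ t ∧ t ≤ r ∧ μ (qball ρ x t ∩ Ω) ≤ μ (qball ρ x r ∩ Ω) / 2}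

/-- The collection `𝔻^s_ρ(u)` of fractional `s`-gradients of `u` on `Ω`. -/
def fracGrad (ρ : X → X → ℝ) (μ : Measure X) (Ω : Set X) (s : ℝ) (u : X → ℝ) :
    Set (ℤ → X → ℝ) :=
  {g | (∀ k x, 0 ≤ g k x) ∧ (∀ k, AEMeasurable (g k) (μ.restrict Ω)) ∧
    ∃ E : Set X, μ E = 0 ∧ ∀ k : ℤ, ∀ x ∈ Ω \ E, ∀ y ∈ Ω \ E,
      (2 : ℝ) ^ (-k - 1) ≤ ρ x y → ρ x y < (2 : ℝ) ^ (-k) →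
      |u x - u y| ≤ ρ x y ^ s * (g k x + g k y)}

/-- `g` is an `s`-gradient of `u` on `S`. -/
def IsSGradOn (ρ : X → X → ℝ) (μ : Measure X) (S : Set X) (s : ℝ) (u g : X → ℝ) : Prop :=
  (∀ x, 0 ≤ g x) ∧ AEMeasurable g (μ.restrict S) ∧
    ∃ E : Set X, μ E = 0 ∧ ∀ x ∈ S \ E, ∀ y ∈ S \ E,
      |u x - u y| ≤ ρ x y ^ s * (g x + g y)

/-- The `ℓ^q` norm (`0 < q ≤ ∞`) of a `ℤ`-indexed sequence in `[0,∞]`. -/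
def lqN (q : ℝ≥0∞) (a : ℤ → ℝ≥0∞) : ℝ≥0∞ :=
  if q = ∞ then ⨆ k, a k else (∑' k, a k ^ q.toReal) ^ (1 / q.toReal)

/-- The `L^p` "norm" (`0 < p < ∞`) of a `[0,∞]`-valued function. -/
def lpN (μ : Measure X) (p : ℝ) (f : X → ℝ≥0∞) : ℝ≥0∞ :=
  (∫⁻ x, f x ^ p ∂μ) ^ (1 / p)

/-- The `L^p` norm of `u : X → ℝ` over the set `Ω`. -/
def lpOn (μ : Measure X) (Ω : Set X) (p : ℝ) (u : X → ℝ) : ℝ≥0∞ :=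
  lpN (μ.restrict Ω) p fun x => ENNReal.ofReal |u x|

/-- The homogeneous Hajłasz–Triebel–Lizorkin quasi-norm `‖u‖_{Ṁ^s_{p,q}(Ω,ρ,μ)}`. -/
def MdotNorm (ρ : X → X → ℝ) (μ : Measure X) (Ω : Set X) (s p : ℝ) (q : ℝ≥0∞)
    (u : X → ℝ) : ℝ≥0∞ :=
  ⨅ g ∈ fracGrad ρ μ Ω s u,
    lpN (μ.restrict Ω) p fun x => lqN q fun k => ENNReal.ofReal (g k x)

/-- The homogeneous Hajłasz–Besov quasi-norm `‖u‖_{Ṅ^s_{p,q}(Ω,ρ,μ)}`. -/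
def NdotNorm (ρ : X → X → ℝ) (μ : Measure X) (Ω : Set X) (s p : ℝ) (q : ℝ≥0∞)
    (u : X → ℝ) : ℝ≥0∞ :=
  ⨅ g ∈ fracGrad ρ μ Ω s u,
    lqN q fun k => lpN (μ.restrict Ω) p fun x => ENNReal.ofReal (g k x)

/-- Membership in `M^s_{p,q}(Ω,ρ,μ)`. -/
def MemMspq (ρ : X → X → ℝ) (μ : Measure X) (Ω : Set X) (s p : ℝ) (q : ℝ≥0∞)
    (u : X → ℝ) : Prop :=
  AEMeasurable u (μ.restrict Ω) ∧ lpOn μ Ω p u ≠ ∞ ∧ MdotNorm ρ μ Ω s p q u ≠ ∞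

/-- Membership in `N^s_{p,q}(Ω,ρ,μ)`. -/
def MemNspq (ρ : X → X → ℝ) (μ : Measure X) (Ω : Set X) (s p : ℝ) (q : ℝ≥0∞)
    (u : X → ℝ) : Prop :=
  AEMeasurable u (μ.restrict Ω) ∧ lpOn μ Ω p u ≠ ∞ ∧ NdotNorm ρ μ Ω s p q u ≠ ∞

/-- The quasi-norm of `M^s_{p,q}(Ω,ρ,μ)`. -/
def MNorm (ρ : X → X → ℝ) (μ : Measure X) (Ω : Set X) (s p : ℝ) (q : ℝ≥0∞)
    (u : X → ℝ) : ℝ≥0∞ :=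
  MdotNorm ρ μ Ω s p q u + lpOn μ Ω p u

/-- The quasi-norm of `N^s_{p,q}(Ω,ρ,μ)`. -/
def NNorm (ρ : X → X → ℝ) (μ : Measure X) (Ω : Set X) (s p : ℝ) (q : ℝ≥0∞)
    (u : X → ℝ) : ℝ≥0∞ :=
  NdotNorm ρ μ Ω s p q u + lpOn μ Ω p u

/-- `s ⪯_q ind(X,ρ)` : there is a quasi-metric `ϱ ≈ ρ` with `s ≤ (log₂ C_ϱ)⁻¹`
(equivalently `C_ϱ ^ s ≤ 2`), where equality is permitted only when `q = ∞`. -/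
def SPrecIndex (ρ : X → X → ℝ) (s : ℝ) (q : ℝ≥0∞) : Prop :=
  ∃ ϱ : X → X → ℝ, IsQuasiDist ϱ ∧ EquivQM ρ ϱ ∧
    (Crho ϱ ^ s < 2 ∨ (q = ∞ ∧ Crho ϱ ^ s ≤ 2))

/-- `s < ind(X,ρ)` : there is a quasi-metric `ϱ ≈ ρ` with `s < (log₂ C_ϱ)⁻¹`
(equivalently `C_ϱ ^ s < 2`). -/
def SLtIndex (ρ : X → X → ℝ) (s : ℝ) : Prop :=
  ∃ ϱ : X → X → ℝ, IsQuasiDist ϱ ∧ EquivQM ρ ϱ ∧ Crho ϱ ^ s < 2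

/-- The median value `m_u(E)`. -/
def medianVal (μ : Measure X) (E : Set X) (u : X → ℝ) : ℝ :=
  sSup {θ : ℝ | μ {x ∈ E | u x < θ} ≤ μ E / 2}

/-- `f` belongs to the homogeneous Hölder space `Ċ^α(X,ρ)`. -/
def MemHolder (ρ : X → X → ℝ) (α : ℝ) (f : X → ℝ) : Prop :=
  ∃ H : ℝ, 0 ≤ H ∧ ∀ x y : X, |f x - f y| ≤ H * ρ x y ^ α

/-- The Hölder seminorm `‖f‖_{Ċ^α(X,ρ)}`. -/
def holderNorm (ρ : X → X → ℝ) (α : ℝ) (f : X → ℝ) : ℝ :=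
  sInf {H : ℝ | 0 ≤ H ∧ ∀ x y : X, |f x - f y| ≤ H * ρ x y ^ α}

/-- The sup norm of `f`. -/
def supNorm (f : X → ℝ) : ℝ := sSup (Set.range fun x => |f x|)

/-- `ρ` is a genuine metric. -/
def IsMetricDist (ρ : X → X → ℝ) : Prop :=
  (∀ x y, 0 ≤ ρ x y) ∧ (∀ x y, ρ x y = 0 ↔ x = y) ∧ (∀ x y, ρ x y = ρ y x) ∧
    (∀ x y z, ρ x y ≤ ρ x z + ρ z y)

/-- The homogeneous Hajłasz–Sobolev quasi-norm `‖u‖_{Ṁ^{1,p}(Ω,ρ,μ)}`. -/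
def M1pDotNorm (ρ : X → X → ℝ) (μ : Measure X) (Ω : Set X) (p : ℝ) (u : X → ℝ) : ℝ≥0∞ :=
  ⨅ g ∈ {g : X → ℝ | IsSGradOn ρ μ Ω 1 u g},
    lpN (μ.restrict Ω) p fun x => ENNReal.ofReal (g x)

/-- Membership in the Hajłasz–Sobolev space `M^{1,p}(Ω,ρ,μ)`. -/
def MemM1p (ρ : X → X → ℝ) (μ : Measure X) (Ω : Set X) (p : ℝ) (u : X → ℝ) : Prop :=
  AEMeasurable u (μ.restrict Ω) ∧ lpOn μ Ω p u ≠ ∞ ∧ M1pDotNorm ρ μ Ω p u ≠ ∞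

/-- The quasi-norm of `M^{1,p}(Ω,ρ,μ)`. -/
def M1pNorm (ρ : X → X → ℝ) (μ : Measure X) (Ω : Set X) (p : ℝ) (u : X → ℝ) : ℝ≥0∞ :=
  lpOn μ Ω p u + M1pDotNorm ρ μ Ω p u


/-- The measure of a quasi-metric measure space is `σ`-finite. -/
theorem IsQMMS.sigmaFinite {ρ : X → X → ℝ} {μ : Measure X} (hX : IsQMMS ρ μ) :
    SigmaFinite μ := by
  obtain ⟨x₀, -, -⟩ := hX.nontrivial
  refine ⟨⟨⟨fun n : ℕ => qball ρ x₀ (n + 1), fun _ => trivial,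
    fun n => hX.ball_lt_top x₀ _ (by positivity), ?_⟩⟩⟩
  refine eq_univ_of_forall fun y => mem_iUnion.2 ?_
  obtain ⟨n, hn⟩ := exists_nat_gt (ρ x₀ y)
  exact ⟨n, show ρ x₀ y < n + 1 by linarith⟩

/-- Any two distinct points of a set being `ε` apart forces the set to be countable. -/
theorem IsQMMS.countable_of_separated {ρ : X → X → ℝ} {μ : Measure X} (hX : IsQMMS ρ μ)
    {ε : ℝ} (hε : 0 < ε) {S : Set X} (hS : S.Pairwise fun x y => ε ≤ ρ x y) :
    S.Countable := by
  have := hX.sigmaFinite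
  obtain ⟨-, -, ⟨C₀, hC₀, hsymm⟩, C₁, hC₁, htri⟩ := hX.quasi
  have hδ : 0 < ε / (C₁ * C₀) := by positivity
  have hdisj : Pairwise (Function.onFun Disjoint
      fun x : S => qball ρ (x : X) (ε / (C₁ * C₀))) := by
    intro x y hxy
    refine Set.disjoint_left.2 fun z hxz hyz => ?_
    have hxz' : ρ x z < ε / (C₁ * C₀) := hxz
    have hyz' : ρ y z < ε / (C₁ * C₀) := hyz
    have hle : ε ≤ ρ x y := hS x.2 y.2 fun h => hxy (Subtype.ext h)
    have hzy : ρ z y < C₀ * (ε / (C₁ * C₀)) :=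
      (hsymm y z).trans_lt (mul_lt_mul_of_pos_left hyz' (by linarith))
    have hxz'' : ρ x z < C₀ * (ε / (C₁ * C₀)) :=
      hxz'.trans_le (le_mul_of_one_le_left hδ.le hC₀)
    have hlt : ρ x y < C₁ * (C₀ * (ε / (C₁ * C₀))) :=
      (htri x y z).trans_lt (mul_lt_mul_of_pos_left (max_lt hxz'' hzy) (by linarith))
    have heq : C₁ * (C₀ * (ε / (C₁ * C₀))) = ε := by field_simp
    linarith
  have hcount := Measure.countable_meas_pos_of_disjoint_iUnion (μ := μ)
    (fun x : S => hX.measurableSet_ball (x : X) _ hδ) hdisj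
  have huniv : {x : S | 0 < μ (qball ρ (x : X) (ε / (C₁ * C₀)))} = univ :=
    eq_univ_of_forall fun x => hX.ball_pos x _ hδ
  rw [huniv] at hcount
  exact countable_coe_iff.1 (countable_univ_iff.1 hcount)

/-- A quasi-metric measure space has a countable `ε`-net for every `ε > 0`. -/
theorem IsQMMS.exists_countable_net {ρ : X → X → ℝ} {μ : Measure X} (hX : IsQMMS ρ μ)
    {ε : ℝ} (hε : 0 < ε) : ∃ D : Set X, D.Countable ∧ ∀ x, ∃ d ∈ D, ρ d x < ε := by
  obtain ⟨-, hzero, ⟨C₀, hC₀, hsymm⟩, -⟩ := hX.quasi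
  have hε' : 0 < ε / C₀ := by positivity
  have hεle : ε / C₀ ≤ ε := div_le_self hε.le hC₀
  obtain ⟨D, hD⟩ := zorn_subset {S : Set X | S.Pairwise fun x y => ε / C₀ ≤ ρ x y}
    (fun c hc hchain => ⟨⋃₀ c, (pairwise_sUnion hchain.directedOn).2 hc,
      fun _ => subset_sUnion_of_mem⟩)
  refine ⟨D, hX.countable_of_separated hε' hD.prop, fun x => ?_⟩
  by_contra! hfar
  have hins : (insert x D).Pairwise fun x y => ε / C₀ ≤ ρ x y := by
    refine pairwise_insert.2 ⟨hD.prop, fun d hd _ => ⟨?_, hεle.trans (hfar d hd)⟩⟩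
    rw [div_le_iff₀' (by linarith)]
    exact (hfar d hd).trans (hsymm x d)
  have hx : x ∈ D := hD.le_of_ge hins (subset_insert x D) (mem_insert x D)
  have := hfar x hx
  rw [(hzero x x).2 rfl] at this
  linarith

/-- Hölder functions on a quasi-metric measure space are measurable. -/
theorem MemHolder.measurable {ρ : X → X → ℝ} {μ : Measure X} (hX : IsQMMS ρ μ)
    {α : ℝ} (hα : 0 < α) {Ψ : X → ℝ} (hΨ : MemHolder ρ α Ψ) : Measurable Ψ := by
  obtain ⟨hnonneg, -, ⟨C₀, hC₀, hsymm⟩, C₁, hC₁, htri⟩ := hX.quasi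
  obtain ⟨H, hH, hΨ⟩ := hΨ
  have hr (n : ℕ) : (0 : ℝ) < 1 / ((n : ℝ) + 1) := by positivity
  choose D hDc hD using fun n : ℕ => hX.exists_countable_net (hr n)
  refine measurable_of_Ioi fun c => ?_
  have hU : Ψ ⁻¹' Ioi c = ⋃ n : ℕ, ⋃ d ∈ {d ∈ D n | qball ρ d (1 / ((n : ℝ) + 1)) ⊆ Ψ ⁻¹' Ioi c},
      qball ρ d (1 / ((n : ℝ) + 1)) := by
    refine Subset.antisymm (fun x hx => ?_)
      (iUnion_subset fun n => iUnion₂_subset fun d hd => hd.2)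
    have hlim : Filter.Tendsto (fun n : ℕ => H * (C₁ * (C₀ * (1 / ((n : ℝ) + 1)))) ^ α)
        Filter.atTop (nhds 0) := by
      have hcont : Continuous fun t : ℝ => H * (C₁ * (C₀ * t)) ^ α :=
        continuous_const.mul (Continuous.rpow_const (by fun_prop) fun _ => Or.inr hα.le)
      have := (hcont.tendsto 0).comp (tendsto_one_div_add_atTop_nhds_zero_nat (𝕜 := ℝ))
      simpa [Real.zero_rpow hα.ne', Function.comp_def] using this
    have hpos : 0 < Ψ x - c := sub_pos.2 hx
    obtain ⟨n, hn⟩ := (hlim.eventually_lt_const hpos).exists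
    obtain ⟨d, hd, hdx⟩ := hD n x
    refine mem_iUnion.2 ⟨n, mem_iUnion₂.2 ⟨d, ⟨hd, fun y hy => ?_⟩, hdx⟩⟩
    have hdy : ρ d y < 1 / ((n : ℝ) + 1) := hy
    have hxd : ρ x d ≤ C₀ * (1 / ((n : ℝ) + 1)) :=
      (hsymm d x).trans (mul_le_mul_of_nonneg_left hdx.le (by linarith))
    have hdy' : ρ d y ≤ C₀ * (1 / ((n : ℝ) + 1)) :=
      hdy.le.trans (le_mul_of_one_le_left (hr n).le hC₀)
    have hxy : ρ x y ≤ C₁ * (C₀ * (1 / ((n : ℝ) + 1))) :=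
      (htri x y d).trans (mul_le_mul_of_nonneg_left (max_le hxd hdy') (by linarith))
    have h := (hΨ x y).trans (mul_le_mul_of_nonneg_left
      (Real.rpow_le_rpow (hnonneg x y) hxy hα.le) hH)
    have := (le_abs_self _).trans h
    show c < Ψ y
    linarith
  rw [hU]
  exact MeasurableSet.iUnion fun n => MeasurableSet.biUnion ((hDc n).mono (sep_subset _ _))
    fun d _ => hX.measurableSet_ball d _ (hr n)

/-! ### The functionals `lpN` and `lqN` -/

theorem add_rpow_le_two_rpow_mul (a b : ℝ≥0∞) {r : ℝ} (hr : 0 < r) :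
    (a + b) ^ r ≤ 2 ^ r * (a ^ r + b ^ r) := by
  rw [← ENNReal.rpow_le_rpow_iff (inv_pos.2 hr), ENNReal.mul_rpow_of_nonneg _ _ (inv_pos.2 hr).le,
    ENNReal.rpow_rpow_inv hr.ne', ENNReal.rpow_rpow_inv hr.ne']
  rcases le_total a b with h | h
  · calc a + b ≤ 2 * b := by rw [two_mul]; gcongr
      _ = 2 * (b ^ r) ^ r⁻¹ := by rw [ENNReal.rpow_rpow_inv hr.ne']
      _ ≤ _ := by gcongr; exact le_add_self
  · calc a + b ≤ 2 * a := by rw [two_mul]; gcongr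
      _ = 2 * (a ^ r) ^ r⁻¹ := by rw [ENNReal.rpow_rpow_inv hr.ne']
      _ ≤ _ := by gcongr; exact le_self_add

theorem lpN_mono {μ : Measure X} {p : ℝ} (hp : 0 < p) {f g : X → ℝ≥0∞} (h : ∀ x, f x ≤ g x) :
    lpN μ p f ≤ lpN μ p g :=
  ENNReal.rpow_le_rpow (lintegral_mono fun x => ENNReal.rpow_le_rpow (h x) hp.le)
    (one_div_pos.2 hp).le

theorem lpN_const_mul {μ : Measure X} {p : ℝ} (hp : 0 < p) {c : ℝ≥0∞} (hc : c ≠ ∞)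
    (f : X → ℝ≥0∞) : lpN μ p (fun x => c * f x) = c * lpN μ p f := by
  unfold lpN
  simp_rw [ENNReal.mul_rpow_of_nonneg _ _ hp.le]
  rw [lintegral_const_mul' _ _ (ENNReal.rpow_ne_top_of_nonneg hp.le hc),
    ENNReal.mul_rpow_of_nonneg _ _ (one_div_pos.2 hp).le, one_div,
    ENNReal.rpow_rpow_inv hp.ne']

theorem lpN_add_le {μ : Measure X} {p : ℝ} (hp : 0 < p) (f : X → ℝ≥0∞) {g : X → ℝ≥0∞}
    (hg : AEMeasurable g μ) :
    lpN μ p (fun x => f x + g x) ≤ 2 * 2 ^ (1 / p) * (lpN μ p f + lpN μ p g) := by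
  have hp' : 0 < 1 / p := one_div_pos.2 hp
  calc lpN μ p (fun x => f x + g x)
      ≤ (∫⁻ x, 2 ^ p * (f x ^ p + g x ^ p) ∂μ) ^ (1 / p) :=
        ENNReal.rpow_le_rpow (lintegral_mono fun x => add_rpow_le_two_rpow_mul _ _ hp) hp'.le
    _ = 2 * (∫⁻ x, f x ^ p ∂μ + ∫⁻ x, g x ^ p ∂μ) ^ (1 / p) := by
        rw [lintegral_const_mul' _ _ (ENNReal.rpow_ne_top_of_nonneg hp.le (by simp)),
          lintegral_add_right' _ (hg.pow_const p), ENNReal.mul_rpow_of_nonneg _ _ hp'.le, one_div,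
          ENNReal.rpow_rpow_inv hp.ne']
    _ ≤ 2 * (2 ^ (1 / p) * (lpN μ p f + lpN μ p g)) := by
        gcongr
        exact add_rpow_le_two_rpow_mul _ _ hp'
    _ = _ := by ring

theorem lpN_restrict_univ_eq {μ : Measure X} {V : Set X} (hV : MeasurableSet V) {p : ℝ}
    (hp : 0 < p) {f : X → ℝ≥0∞} (hf : ∀ x ∉ V, f x = 0) :
    lpN (μ.restrict univ) p f = lpN (μ.restrict V) p f := by
  unfold lpN
  rw [← lintegral_indicator hV, Measure.restrict_univ]
  congr 2
  funext x
  by_cases hx : x ∈ V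
  · simp [hx]
  · simp [hx, hf x hx, hp]

theorem lqN_eq_lpN_count {q : ℝ≥0∞} (hq : q ≠ ∞) (a : ℤ → ℝ≥0∞) :
    lqN q a = lpN Measure.count q.toReal a := by
  simp [lqN, lpN, hq, lintegral_count]

theorem lqN_mono {q : ℝ≥0∞} (hq : 0 < q) {a b : ℤ → ℝ≥0∞} (h : ∀ k, a k ≤ b k) :
    lqN q a ≤ lqN q b := by
  by_cases hq' : q = ∞
  · simpa [lqN, hq'] using fun k => le_iSup_of_le k (h k)
  · simpa [lqN_eq_lpN_count hq'] using lpN_mono (ENNReal.toReal_pos hq.ne' hq') h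

theorem lqN_const_mul {q : ℝ≥0∞} (hq : 0 < q) {c : ℝ≥0∞} (hc : c ≠ ∞) (a : ℤ → ℝ≥0∞) :
    lqN q (fun k => c * a k) = c * lqN q a := by
  by_cases hq' : q = ∞
  · simp [lqN, hq', ENNReal.mul_iSup]
  · simpa [lqN_eq_lpN_count hq'] using lpN_const_mul (ENNReal.toReal_pos hq.ne' hq') hc a

theorem exists_lqN_add_le {q : ℝ≥0∞} (hq : 0 < q) : ∃ K : ℝ≥0∞, K ≠ ∞ ∧ 1 ≤ K ∧
    ∀ a b : ℤ → ℝ≥0∞, lqN q (fun k => a k + b k) ≤ K * (lqN q a + lqN q b) := by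
  by_cases hq' : q = ∞
  · refine ⟨1, by simp, le_rfl, fun a b => ?_⟩
    simpa [lqN, hq'] using fun k => add_le_add (le_iSup a k) (le_iSup b k)
  · have hr : 0 < q.toReal := ENNReal.toReal_pos hq.ne' hq'
    refine ⟨2 * 2 ^ (1 / q.toReal), ?_, ?_, fun a b => ?_⟩
    · exact ENNReal.mul_ne_top (by simp)
        (ENNReal.rpow_ne_top_of_nonneg (one_div_pos.2 hr).le (by simp))
    · exact one_le_mul one_le_two (ENNReal.one_le_rpow one_le_two (one_div_pos.2 hr))
    · simpa only [lqN_eq_lpN_count hq'] using lpN_add_le hr a (Measurable.of_discrete).aemeasurable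

theorem lqN_zero {q : ℝ≥0∞} (hq : 0 < q) : lqN q (fun _ => 0) = 0 := by
  simpa using lqN_const_mul hq (c := 0) (by simp) fun _ => 0

/-! ### The multiplier weights -/

/-- The weight bounding `|Ψ x - Ψ y| / ρ x y ^ s` at scale `ρ x y ∼ 2 ^ (-k)`, when `Ψ` is
`α`-Hölder with constant `H` and is bounded by `M`. -/
def multWeight (H M α s : ℝ) (k : ℤ) : ℝ :=
  min (H * ((2 : ℝ) ^ (-k)) ^ (α - s)) (2 * M * ((2 : ℝ) ^ (k + 1)) ^ s)

theorem multWeight_nonneg {H M : ℝ} (hH : 0 ≤ H) (hM : 0 ≤ M) (α s : ℝ) (k : ℤ) :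
    0 ≤ multWeight H M α s k := by
  unfold multWeight; positivity

theorem abs_sub_le_multWeight {H M α s : ℝ} (hH : 0 ≤ H) (hM : 0 ≤ M) (hs : 0 < s)
    (hsα : s ≤ α) {a b r : ℝ} {k : ℤ} (hk : (2 : ℝ) ^ (-k - 1) ≤ r) (hk' : r < (2 : ℝ) ^ (-k))
    (ha : |a| ≤ M) (hb : |b| ≤ M) (hab : |a - b| ≤ H * r ^ α) :
    |a - b| ≤ r ^ s * multWeight H M α s k := by
  have hr : 0 < r := lt_of_lt_of_le (by positivity) hk
  unfold multWeight
  rw [mul_min_of_nonneg _ _ (by positivity)]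
  refine le_min ?_ ?_
  · calc |a - b| ≤ H * r ^ α := hab
      _ = r ^ s * (H * r ^ (α - s)) := by
        rw [show α = s + (α - s) by ring, Real.rpow_add hr]; ring_nf
      _ ≤ _ := by
        gcongr
  · have h1 : 1 ≤ r ^ s * ((2 : ℝ) ^ (k + 1)) ^ s := by
      rw [← Real.mul_rpow hr.le (by positivity)]
      refine Real.one_le_rpow ?_ hs.le
      calc (1 : ℝ) = 2 ^ (-k - 1) * 2 ^ (k + 1) := by
            rw [← zpow_add₀ (by norm_num)]; simp
        _ ≤ _ := by gcongr
    calc |a - b| ≤ |a| + |b| := abs_sub a b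
      _ ≤ 2 * M * 1 := by linarith
      _ ≤ 2 * M * (r ^ s * ((2 : ℝ) ^ (k + 1)) ^ s) := by gcongr
      _ = _ := by ring

theorem multWeight_le {H M α s : ℝ} (hH : 0 ≤ H) (k : ℤ) :
    multWeight H M α s k ≤
      max H (2 * M * 2 ^ s) * ((2 : ℝ) ^ (-min (α - s) s)) ^ k.natAbs := by
  have hpow (n : ℕ) : ((2 : ℝ) ^ (-min (α - s) s)) ^ n = 2 ^ (-(n * min (α - s) s)) := by
    rw [← Real.rpow_natCast, ← Real.rpow_mul (by norm_num)]; ring_nf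
  have hz (m : ℤ) (t : ℝ) : ((2 : ℝ) ^ m) ^ t = 2 ^ (m * t) := by
    rw [← Real.rpow_intCast, ← Real.rpow_mul (by norm_num)]
  rw [hpow, multWeight, hz, hz]
  obtain ⟨n, rfl | rfl⟩ := k.eq_nat_or_neg
  · refine (min_le_left _ _).trans (mul_le_mul (le_max_left _ _) ?_ (by positivity)
      (le_max_of_le_left hH))
    refine Real.rpow_le_rpow_of_exponent_le one_le_two ?_
    push_cast
    simp only [Int.natAbs_natCast, neg_mul]
    gcongr
    exact min_le_left _ _
  · refine (min_le_right _ _).trans ?_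
    have : (2 : ℝ) ^ (((-(n : ℤ) + 1 : ℤ) : ℝ) * s) = 2 ^ s * 2 ^ (-(n * s)) := by
      rw [← Real.rpow_add (by norm_num)]; push_cast; ring_nf
    rw [this, ← mul_assoc]
    refine mul_le_mul (le_max_right _ _) ?_ (by positivity) (le_max_of_le_left hH)
    refine Real.rpow_le_rpow_of_exponent_le one_le_two ?_
    simp only [Int.natAbs_neg, Int.natAbs_natCast]
    gcongr
    exact min_le_right _ _

theorem lqN_multWeight_ne_top {H M α s : ℝ} {q : ℝ≥0∞} (hH : 0 ≤ H) (hq : 0 < q)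
    (hs : 0 < s) (hsα : s ≤ α) (hcrit : s = α → q = ∞) :
    lqN q (fun k => ENNReal.ofReal (multWeight H M α s k)) ≠ ∞ := by
  set L := max H (2 * M * 2 ^ s)
  have hL : 0 ≤ L := le_max_of_le_left hH
  set θ : ℝ := 2 ^ (-min (α - s) s)
  have hθ : 0 < θ := by positivity
  refine ne_top_of_le_ne_top ?_ (lqN_mono hq fun k =>
    ENNReal.ofReal_le_ofReal (multWeight_le hH k))
  by_cases hq' : q = ∞
  · have hθ1 : θ ≤ 1 := Real.rpow_le_one_of_one_le_of_nonpos one_le_two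
      (neg_nonpos.2 (le_min (by linarith) hs.le))
    simp only [lqN, hq', if_true]
    refine ne_top_of_le_ne_top (ENNReal.ofReal_ne_top (r := L)) (iSup_le fun k => ?_)
    exact ENNReal.ofReal_le_ofReal (mul_le_of_le_one_right hL (pow_le_one₀ hθ.le hθ1))
  · have hr : 0 < q.toReal := ENNReal.toReal_pos hq.ne' hq'
    have hsα' : s < α := lt_of_le_of_ne hsα fun h => hq' (hcrit h)
    have hθ1 : θ < 1 := Real.rpow_lt_one_of_one_lt_of_neg one_lt_two
      (neg_neg_of_pos (lt_min (by linarith) hs))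
    have hgeom : Summable fun n : ℕ => L ^ q.toReal * (θ ^ q.toReal) ^ n :=
      (summable_geometric_of_lt_one (by positivity) (Real.rpow_lt_one hθ.le hθ1 hr)).mul_left _
    have hsum : Summable fun k : ℤ => L ^ q.toReal * (θ ^ q.toReal) ^ k.natAbs :=
      Summable.of_nat_of_neg (by simpa using hgeom) (by simpa using hgeom)
    simp only [lqN, hq', if_false]
    refine ENNReal.rpow_ne_top_of_nonneg (one_div_pos.2 hr).le ?_
    convert hsum.tsum_ofReal_ne_top using 4 with k
    rw [ENNReal.ofReal_rpow_of_nonneg (by positivity) hr.le,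
      Real.mul_rpow hL (by positivity), ← Real.rpow_natCast, ← Real.rpow_natCast,
      ← Real.rpow_mul hθ.le, ← Real.rpow_mul hθ.le, mul_comm q.toReal]

/-! ### The product estimate -/

/-- A fractional gradient of `Ψ f` on `X` built from one of `f` on `V`. -/
def multGrad (H M α s : ℝ) (V : Set X) (f : X → ℝ) (g : ℤ → X → ℝ) (k : ℤ) : X → ℝ :=
  V.indicator fun x => M * g k x + multWeight H M α s k * |f x|

theorem multGrad_mem_fracGrad {ρ : X → X → ℝ} {μ : Measure X} {H M α s : ℝ} {V : Set X}
    (hV : MeasurableSet V) (hH : 0 ≤ H) (hM : 0 ≤ M) (hs : 0 < s) (hsα : s ≤ α) {Ψ f : X → ℝ}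
    (hρ : ∀ x y, 0 ≤ ρ x y)
    (hΨH : ∀ x y, |Ψ x - Ψ y| ≤ H * ρ x y ^ α) (hΨM : ∀ x, |Ψ x| ≤ M) (hΨ0 : ∀ x ∉ V, Ψ x = 0)
    (hf : AEMeasurable f (μ.restrict V)) {g : ℤ → X → ℝ} (hg : g ∈ fracGrad ρ μ V s f) :
    multGrad H M α s V f g ∈ fracGrad ρ μ univ s fun x => Ψ x * f x := by
  obtain ⟨hg0, hgm, E, hE, hgE⟩ := hg
  have hw := multWeight_nonneg hH hM α s
  have hin {k : ℤ} {x : X} (hx : x ∈ V) :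
      multGrad H M α s V f g k x = M * g k x + multWeight H M α s k * |f x| :=
    indicator_of_mem hx _
  have hout {k : ℤ} {x : X} (hx : x ∉ V) : multGrad H M α s V f g k x = 0 :=
    indicator_of_notMem hx _
  refine ⟨fun k x => ?_, fun k => ?_, E, hE, fun k x hx y hy hk hk' => ?_⟩
  · refine indicator_nonneg (fun x _ => ?_) x
    have := hg0 k x
    have := hw k
    positivity
  · rw [Measure.restrict_univ]
    refine (aemeasurable_indicator_iff hV).2 ?_
    exact ((hgm k).const_mul M).add ((measurable_abs.comp_aemeasurable hf).const_mul _)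
  have hdiff := abs_sub_le_multWeight hH hM hs hsα hk hk' (hΨM x) (hΨM y) (hΨH x y)
  have hrs : 0 ≤ ρ x y ^ s := Real.rpow_nonneg (hρ x y) s
  by_cases hxV : x ∈ V <;> by_cases hyV : y ∈ V
  · rw [hin hxV, hin hyV]
    have hfg := hgE k x ⟨hxV, hx.2⟩ y ⟨hyV, hy.2⟩ hk hk'
    have hwx : 0 ≤ ρ x y ^ s * (multWeight H M α s k * |f x|) := by
      have := hw k
      positivity
    calc |Ψ x * f x - Ψ y * f y|
        = |Ψ x * (f x - f y) + (Ψ x - Ψ y) * f y| := by ring_nf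
      _ ≤ |Ψ x| * |f x - f y| + |Ψ x - Ψ y| * |f y| := by
          simpa only [abs_mul] using abs_add_le (Ψ x * (f x - f y)) ((Ψ x - Ψ y) * f y)
      _ ≤ M * (ρ x y ^ s * (g k x + g k y)) + ρ x y ^ s * multWeight H M α s k * |f y| := by
          gcongr
          exact hΨM x
      _ ≤ _ := by linarith
  · rw [hin hxV, hout hyV]
    have hMg : 0 ≤ ρ x y ^ s * (M * g k x) := by
      have := hg0 k x
      positivity
    rw [hΨ0 y hyV, sub_zero] at hdiff
    simp only
    rw [hΨ0 y hyV, zero_mul, sub_zero, abs_mul]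
    calc |Ψ x| * |f x| ≤ ρ x y ^ s * multWeight H M α s k * |f x| := by gcongr
      _ ≤ _ := by linarith
  · rw [hout hxV, hin hyV]
    have hMg : 0 ≤ ρ x y ^ s * (M * g k y) := by
      have := hg0 k y
      positivity
    rw [hΨ0 x hxV, zero_sub, abs_neg] at hdiff
    simp only
    rw [hΨ0 x hxV, zero_mul, zero_sub, abs_neg, abs_mul]
    calc |Ψ y| * |f y| ≤ ρ x y ^ s * multWeight H M α s k * |f y| := by gcongr
      _ ≤ _ := by linarith
  · simp [hΨ0 x hxV, hΨ0 y hyV, hout hxV, hout hyV]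

theorem ofReal_multGrad_le {H M α s : ℝ} {V : Set X} (hH : 0 ≤ H) (hM : 0 ≤ M)
    {f : X → ℝ} {g : ℤ → X → ℝ} (hg : ∀ k x, 0 ≤ g k x) (k : ℤ) (x : X) :
    ENNReal.ofReal (multGrad H M α s V f g k x) ≤
      ENNReal.ofReal M * ENNReal.ofReal (g k x) +
        ENNReal.ofReal (multWeight H M α s k) * ENNReal.ofReal |f x| := by
  have hw := multWeight_nonneg hH hM α s k
  rw [← ENNReal.ofReal_mul hM, ← ENNReal.ofReal_mul hw,
    ← ENNReal.ofReal_add (mul_nonneg hM (hg k x)) (mul_nonneg hw (abs_nonneg _))]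
  refine ENNReal.ofReal_le_ofReal (indicator_le_self' (fun z _ => ?_) x)
  have := hg k z
  positivity

theorem le_mul_iInf₂_add {ι : Type*} {S : Set ι} {F : ι → ℝ≥0∞} {D A B : ℝ≥0∞} (hA0 : A ≠ 0)
    (hA : A ≠ ∞) (h : ∀ i ∈ S, D ≤ A * F i + B) : D ≤ A * (⨅ i ∈ S, F i) + B := by
  rw [← tsub_le_iff_right, ← ENNReal.div_le_iff' hA0 hA]
  refine le_iInf₂ fun i hi => ?_
  rw [ENNReal.div_le_iff' hA0 hA, tsub_le_iff_right]
  exact h i hi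

/-- Mixed-norm estimate for `multGrad` in the Triebel–Lizorkin scale. -/
theorem lpN_lqN_multGrad_le {μ : Measure X} {H M α s p : ℝ} {q K : ℝ≥0∞} {V : Set X}
    (hV : MeasurableSet V) (hH : 0 ≤ H) (hM : 0 ≤ M) (hp : 0 < p) (hq : 0 < q) (hK : K ≠ ∞)
    (hKadd : ∀ a b : ℤ → ℝ≥0∞, lqN q (fun k => a k + b k) ≤ K * (lqN q a + lqN q b))
    (hW : lqN q (fun k => ENNReal.ofReal (multWeight H M α s k)) ≠ ∞)
    {f : X → ℝ} (hf : AEMeasurable f (μ.restrict V)) {g : ℤ → X → ℝ} (hg : ∀ k x, 0 ≤ g k x) :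
    lpN (μ.restrict univ) p
        (fun x => lqN q fun k => ENNReal.ofReal (multGrad H M α s V f g k x)) ≤
      2 * 2 ^ (1 / p) * K * ENNReal.ofReal M *
          lpN (μ.restrict V) p (fun x => lqN q fun k => ENNReal.ofReal (g k x)) +
        2 * 2 ^ (1 / p) * K * lqN q (fun k => ENNReal.ofReal (multWeight H M α s k)) *
          lpOn μ V p f := by
  set W := lqN q (fun k => ENNReal.ofReal (multWeight H M α s k))
  rw [lpN_restrict_univ_eq hV hp fun x hx => by simp [multGrad, hx, lqN_zero hq]]
  have hpt (x : X) : lqN q (fun k => ENNReal.ofReal (multGrad H M α s V f g k x)) ≤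
      K * ENNReal.ofReal M * lqN q (fun k => ENNReal.ofReal (g k x)) +
        K * W * ENNReal.ofReal |f x| := by
    refine (lqN_mono hq fun k => ofReal_multGrad_le hH hM hg k x).trans ((hKadd _ _).trans ?_)
    simp_rw [mul_comm (ENNReal.ofReal (multWeight H M α s _))]
    rw [lqN_const_mul hq ENNReal.ofReal_ne_top, lqN_const_mul hq ENNReal.ofReal_ne_top]
    exact le_of_eq (by ring)
  have hfm : AEMeasurable (fun x => K * W * ENNReal.ofReal |f x|) (μ.restrict V) :=
    (measurable_abs.comp_aemeasurable hf).ennreal_ofReal.const_mul _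
  refine (lpN_mono hp hpt).trans ((lpN_add_le hp _ hfm).trans ?_)
  rw [lpN_const_mul hp (ENNReal.mul_ne_top hK ENNReal.ofReal_ne_top),
    lpN_const_mul hp (ENNReal.mul_ne_top hK hW)]
  exact le_of_eq (by unfold lpOn; ring)

/-- Mixed-norm estimate for `multGrad` in the Besov scale. -/
theorem lqN_lpN_multGrad_le {μ : Measure X} {H M α s p : ℝ} {q K : ℝ≥0∞} {V : Set X}
    (hV : MeasurableSet V) (hH : 0 ≤ H) (hM : 0 ≤ M) (hp : 0 < p) (hq : 0 < q)
    (hKadd : ∀ a b : ℤ → ℝ≥0∞, lqN q (fun k => a k + b k) ≤ K * (lqN q a + lqN q b))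
    {f : X → ℝ} (hf : AEMeasurable f (μ.restrict V)) (hfp : lpOn μ V p f ≠ ∞)
    {g : ℤ → X → ℝ} (hg : ∀ k x, 0 ≤ g k x) :
    lqN q (fun k => lpN (μ.restrict univ) p
        fun x => ENNReal.ofReal (multGrad H M α s V f g k x)) ≤
      2 * 2 ^ (1 / p) * K * ENNReal.ofReal M *
          lqN q (fun k => lpN (μ.restrict V) p fun x => ENNReal.ofReal (g k x)) +
        2 * 2 ^ (1 / p) * K * lqN q (fun k => ENNReal.ofReal (multWeight H M α s k)) *
          lpOn μ V p f := by
  set T : ℝ≥0∞ := 2 * 2 ^ (1 / p)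
  have hT : T ≠ ∞ := ENNReal.mul_ne_top (by simp)
    (ENNReal.rpow_ne_top_of_nonneg (one_div_pos.2 hp).le (by simp))
  have hpt (k : ℤ) : lpN (μ.restrict univ) p
        (fun x => ENNReal.ofReal (multGrad H M α s V f g k x)) ≤
      T * ENNReal.ofReal M * lpN (μ.restrict V) p (fun x => ENNReal.ofReal (g k x)) +
        T * lpOn μ V p f * ENNReal.ofReal (multWeight H M α s k) := by
    rw [lpN_restrict_univ_eq hV hp fun x hx => by simp [multGrad, hx]]
    refine (lpN_mono hp fun x => ofReal_multGrad_le hH hM hg k x).trans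
      ((lpN_add_le hp _
        ((measurable_abs.comp_aemeasurable hf).ennreal_ofReal.const_mul _)).trans ?_)
    rw [lpN_const_mul hp ENNReal.ofReal_ne_top, lpN_const_mul hp ENNReal.ofReal_ne_top]
    exact le_of_eq (by simp only [lpOn, T, Function.comp_apply]; ring)
  refine (lqN_mono hq hpt).trans ((hKadd _ _).trans ?_)
  rw [lqN_const_mul hq (ENNReal.mul_ne_top hT ENNReal.ofReal_ne_top),
    lqN_const_mul hq (ENNReal.mul_ne_top hT hfp)]
  exact le_of_eq (by ring)

theorem lpOn_univ_mul_le {μ : Measure X} {V : Set X} (hV : MeasurableSet V) {p M : ℝ}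
    (hp : 0 < p) {Ψ : X → ℝ} (hΨM : ∀ x, |Ψ x| ≤ M) (hΨ0 : ∀ x ∉ V, Ψ x = 0) (f : X → ℝ) :
    lpOn μ univ p (fun x => Ψ x * f x) ≤ ENNReal.ofReal M * lpOn μ V p f := by
  unfold lpOn
  rw [lpN_restrict_univ_eq hV hp fun x hx => by simp [hΨ0 x hx],
    ← lpN_const_mul hp ENNReal.ofReal_ne_top]
  refine lpN_mono hp fun x => ?_
  rw [abs_mul, ENNReal.ofReal_mul (abs_nonneg _)]
  gcongr
  exact hΨM x

theorem aemeasurable_mul_of_eq_zero {μ : Measure X} {V : Set X} (hV : MeasurableSet V)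
    {Ψ f : X → ℝ} (hΨ : Measurable Ψ) (hΨ0 : ∀ x ∉ V, Ψ x = 0)
    (hf : AEMeasurable f (μ.restrict V)) :
    AEMeasurable (fun x => Ψ x * f x) (μ.restrict univ) := by
  have heq : (fun x => Ψ x * f x) = V.indicator fun x => Ψ x * f x := by
    refine (indicator_eq_self.2 fun x hx => ?_).symm
    by_contra hxV
    simp [hΨ0 x hxV] at hx
  rw [heq, Measure.restrict_univ, aemeasurable_indicator_iff hV]
  exact hΨ.aemeasurable.mul hf

/-- Lemma 3.11 (multiplier boundedness): a bounded Hölder function `Ψ` vanishing outside `V`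
acts as a pointwise multiplier from `M^s_{p,q}(V)` into `M^s_{p,q}(X)`, and likewise
for `N^s_{p,q}`. -/
theorem multiplier_bounded_on_M_and_N
    {X : Type*} [MeasurableSpace X] (ρ : X → X → ℝ) (μ : Measure X)
    (hX : IsQMMS ρ μ)
    (α p s : ℝ) (q : ℝ≥0∞) (hα : 0 < α) (hp : 0 < p) (hq : 0 < q)
    (hs : 0 < s) (hsα : s ≤ α) (hcrit : s = α → q = ∞)
    (Ψ : X → ℝ) (hΨH : MemHolder ρ α Ψ) (hΨbdd : ∃ M : ℝ, ∀ x, |Ψ x| ≤ M)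
    (V : Set X) (hV : MeasurableSet V) (hΨ0 : ∀ x ∉ V, Ψ x = 0) :
    ∃ C : ℝ, 0 < C ∧
      (∀ f : X → ℝ, MemMspq ρ μ V s p q f →
        MemMspq ρ μ Set.univ s p q (fun x => Ψ x * f x) ∧
        MNorm ρ μ Set.univ s p q (fun x => Ψ x * f x) ≤
          ENNReal.ofReal C * MNorm ρ μ V s p q f) ∧
      (∀ f : X → ℝ, MemNspq ρ μ V s p q f →
        MemNspq ρ μ Set.univ s p q (fun x => Ψ x * f x) ∧
        NNorm ρ μ Set.univ s p q (fun x => Ψ x * f x) ≤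
          ENNReal.ofReal C * NNorm ρ μ V s p q f) := by
  obtain ⟨H, hH, hΨH'⟩ := hΨH
  obtain ⟨M₀, hM₀⟩ := hΨbdd
  set M := max M₀ 1
  have hM1 : 1 ≤ M := le_max_right _ _
  have hM : 0 ≤ M := by linarith
  have hΨM (x : X) : |Ψ x| ≤ M := (hM₀ x).trans (le_max_left _ _)
  have hΨmeas : Measurable Ψ := MemHolder.measurable hX hα ⟨H, hH, hΨH'⟩
  obtain ⟨K, hK, hK1, hKadd⟩ := exists_lqN_add_le hq
  have hW := lqN_multWeight_ne_top (M := M) hH hq hs hsα hcrit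
  set W := lqN q (fun k => ENNReal.ofReal (multWeight H M α s k))
  set T : ℝ≥0∞ := 2 * 2 ^ (1 / p)
  have hT : T ≠ ∞ := ENNReal.mul_ne_top (by simp)
    (ENNReal.rpow_ne_top_of_nonneg (one_div_pos.2 hp).le (by simp))
  have hT0 : T ≠ 0 := by simp [T]
  set A := T * K * ENNReal.ofReal M
  set B := T * K * W
  have hA : A ≠ ∞ := ENNReal.mul_ne_top (ENNReal.mul_ne_top hT hK) ENNReal.ofReal_ne_top
  have hB : B ≠ ∞ := ENNReal.mul_ne_top (ENNReal.mul_ne_top hT hK) hW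
  have hA0 : A ≠ 0 := mul_ne_zero (mul_ne_zero hT0 (one_pos.trans_le hK1).ne')
    (ENNReal.ofReal_pos.2 (by linarith)).ne'
  set C := A + (B + ENNReal.ofReal M)
  have hC : C ≠ ∞ := ENNReal.add_ne_top.2 ⟨hA, ENNReal.add_ne_top.2 ⟨hB, ENNReal.ofReal_ne_top⟩⟩
  have hC0 : C ≠ 0 := fun h => hA0 (add_eq_zero.1 h).1
  have hsum {D N L L' : ℝ≥0∞} (hD : D ≤ A * N + B * L) (hL : L' ≤ ENNReal.ofReal M * L) :
      D + L' ≤ C * (N + L) :=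
    calc D + L' ≤ A * N + B * L + ENNReal.ofReal M * L := add_le_add hD hL
      _ = A * N + (B + ENNReal.ofReal M) * L := by ring
      _ ≤ C * N + C * L := by
        gcongr
        · exact le_self_add
        · exact le_add_self
      _ = C * (N + L) := by ring
  refine ⟨C.toReal, ENNReal.toReal_pos hC0 hC, fun f hf => ?_, fun f hf => ?_⟩
  all_goals
    rw [ENNReal.ofReal_toReal hC]
    obtain ⟨hfm, hfp, hfg⟩ := hf
    have hL := lpOn_univ_mul_le (μ := μ) hV hp hΨM hΨ0 f
    have hgrad (g) (hg : g ∈ fracGrad ρ μ V s f) :=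
      multGrad_mem_fracGrad hV hH hM hs hsα hX.quasi.1 hΨH' hΨM hΨ0 hfm hg
  · have hD : MdotNorm ρ μ univ s p q (fun x => Ψ x * f x) ≤
        A * MdotNorm ρ μ V s p q f + B * lpOn μ V p f :=
      le_mul_iInf₂_add hA0 hA fun g hg => (iInf₂_le _ (hgrad g hg)).trans
        (lpN_lqN_multGrad_le hV hH hM hp hq hK hKadd hW hfm hg.1)
    exact ⟨⟨aemeasurable_mul_of_eq_zero hV hΨmeas hΨ0 hfm,
      ne_top_of_le_ne_top (ENNReal.mul_ne_top ENNReal.ofReal_ne_top hfp) hL,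
      ne_top_of_le_ne_top (ENNReal.add_ne_top.2
        ⟨ENNReal.mul_ne_top hA hfg, ENNReal.mul_ne_top hB hfp⟩) hD⟩, hsum hD hL⟩
  · have hD : NdotNorm ρ μ univ s p q (fun x => Ψ x * f x) ≤
        A * NdotNorm ρ μ V s p q f + B * lpOn μ V p f :=
      le_mul_iInf₂_add hA0 hA fun g hg => (iInf₂_le _ (hgrad g hg)).trans
        (lqN_lpN_multGrad_le hV hH hM hp hq hKadd hfm hfp hg.1)
    exact ⟨⟨aemeasurable_mul_of_eq_zero hV hΨmeas hΨ0 hfm,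
      ne_top_of_le_ne_top (ENNReal.mul_ne_top ENNReal.ofReal_ne_top hfp) hL,
      ne_top_of_le_ne_top (ENNReal.add_ne_top.2
        ⟨ENNReal.mul_ne_top hA hfg, ENNReal.mul_ne_top hB hfp⟩) hD⟩, hsum hD hL⟩

end HajlaszPaper
end
end

section
/- Let (X,ρ,μ) be a quasi-metric measure space in which μ is Q-doubling for some Q ∈ (0,∞), and let Ω ⊂ X be a nonempty μ-measurable set satisfying the measure density condition. Then for every s ∈ (0,∞), every p ∈ (0,Q/s), and every q ∈ (0,∞], there is a constant C_S > 0 such that for every ρ-ball B₀ = B_ρ(x₀,R₀) with x₀ ∈ Ω and R₀ ∈ (0,1], and every u ∈ Ṁ^s_{p,q}(Ω,ρ,μ): ‖u‖_{L^{p*}(B₀∩Ω)} ≤ (C_S / μ(B₀)^{s/Q}) [ R₀^s ‖u‖_{Ṁ^s_{p,q}(Ω,ρ,μ)} + ‖u‖_{L^p(Ω)} ], where p* := Qp/(Q−sp). -/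
open MeasureTheory ENNReal Set

noncomputable section

namespace HajlaszPaper

variable {X : Type*}

variable [MeasurableSpace X]

theorem abs_le_of_geometric_steps {v : ℕ → ℝ} {t D : ℝ} (ht : 1 < t) (hD : 0 ≤ D)
    (h : ∀ j, |v j - v (j + 1)| ≤ D * t ^ j) (j : ℕ) :
    |v j| ≤ |v 0| + D / (t - 1) * t ^ j := by
  have ht' : 0 < t - 1 := by linarith
  induction j with
  | zero =>
    have : 0 ≤ D / (t - 1) := by positivity
    simpa using this
  | succ j ih =>
    have h1 := h j
    have h2 : |v (j + 1)| ≤ |v j| + |v j - v (j + 1)| := by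
      have := abs_sub (v j) (v j - v (j + 1))
      simpa using this
    have h3 : D / (t - 1) * t ^ (j + 1) = D / (t - 1) * t ^ j + D * t ^ j := by
      field_simp
      ring
    linarith

/-- A pointwise estimate of `u x` by a power of an `s`-gradient at `x`, provided that all dyadic
balls around `x` contain points at which `u` and the gradient are controlled. -/
theorem abs_le_of_controlled_points {X : Type*} {ρ : X → X → ℝ} {u g : X → ℝ} {S : Set X} {x : X}
    {s C R a N U τ t θ : ℝ}
    (hs : 0 < s) (hC : 0 ≤ C) (hR : 0 < R) (ha : 0 < a) (hN : 0 < N) (hU : 0 < U)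
    (hτ : 1 < τ) (ht : 1 < t) (hθ : 0 ≤ θ) (htτ : t = (1 / 2 : ℝ) ^ s * τ) (htθ : t = τ ^ θ)
    (hxS : x ∈ S) (hρ : ∀ y z, 0 ≤ ρ y z) (hxx : ρ x x = 0) (hg : ∀ y, 0 ≤ g y)
    (hgrad : ∀ y ∈ S, ∀ z ∈ S, |u y - u z| ≤ ρ y z ^ s * (g y + g z))
    (hpair : ∀ y z r, ρ x y < r → ρ x z < r → ρ y z ≤ C * r)
    (hpts : ∀ j : ℕ, ∃ y ∈ S, ρ x y < R * (1 / 2) ^ j ∧ g y ≤ N * (a * τ ^ j) ∧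
      |u y| ≤ U * (a * τ ^ j)) :
    |u x| ≤ (1 + (C ^ s * (1 + τ) / (t - 1) + 2 * C ^ s) * (1 + t)) * a * (U + R ^ s * N) *
      (1 + (g x / (N * a)) ^ θ) := by
  choose y hyS hyρ hyg hyu using hpts
  have hNa : 0 < N * a := by positivity
  have hpow : ∀ j : ℕ, (C * (R * (1 / 2) ^ j)) ^ s * τ ^ j = C ^ s * R ^ s * t ^ j := by
    intro j
    rw [Real.mul_rpow hC (by positivity), Real.mul_rpow hR.le (by positivity),
      ← Real.rpow_pow_comm (by norm_num), htτ, mul_pow]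
    ring
  have hstep : ∀ j, |u (y j) - u (y (j + 1))| ≤ (C ^ s * R ^ s * (N * a) * (1 + τ)) * t ^ j := by
    intro j
    have hr : R * (1 / 2 : ℝ) ^ (j + 1) ≤ R * (1 / 2) ^ j := by
      rw [pow_succ]
      have : 0 < R * (1 / 2 : ℝ) ^ j := by positivity
      linarith
    calc |u (y j) - u (y (j + 1))|
        ≤ ρ (y j) (y (j + 1)) ^ s * (g (y j) + g (y (j + 1))) := hgrad _ (hyS j) _ (hyS _)
      _ ≤ (C * (R * (1 / 2) ^ j)) ^ s * (N * (a * τ ^ j) + N * (a * τ ^ (j + 1))) := by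
        gcongr
        · exact add_nonneg (hg _) (hg _)
        · exact hρ _ _
        · exact hpair _ _ _ (hyρ j) ((hyρ (j + 1)).trans_le hr)
        · exact hyg j
        · exact hyg (j + 1)
      _ = ((C * (R * (1 / 2) ^ j)) ^ s * τ ^ j) * ((N * a) * (1 + τ)) := by ring
      _ = _ := by rw [hpow]; ring
  have hex : ∃ j : ℕ, g x ≤ N * a * τ ^ j := by
    obtain ⟨n, hn⟩ := pow_unbounded_of_one_lt (g x / (N * a)) hτ
    exact ⟨n, by rw [div_lt_iff₀ hNa] at hn; linarith⟩
  classical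
  set j := Nat.find hex
  have hgj : g x ≤ N * a * τ ^ j := Nat.find_spec hex
  have hz : 0 ≤ (g x / (N * a)) ^ θ := Real.rpow_nonneg (div_nonneg (hg x) hNa.le) _
  have htj : t ^ j ≤ 1 + t * (g x / (N * a)) ^ θ := by
    rcases Nat.eq_zero_or_pos j with h0 | h0
    · rw [h0, pow_zero]
      have : 0 ≤ t * (g x / (N * a)) ^ θ := by positivity
      linarith
    · obtain ⟨i, hi⟩ : ∃ i, j = i + 1 := ⟨j - 1, by omega⟩
      have hlt : N * a * τ ^ i < g x := not_le.1 (Nat.find_min hex (show i < j by omega))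
      have h1 : τ ^ i ≤ g x / (N * a) := by
        rw [le_div_iff₀ hNa]; linarith
      have h2 : t ^ i ≤ (g x / (N * a)) ^ θ := by
        rw [htθ, Real.rpow_pow_comm (by linarith)]
        exact Real.rpow_le_rpow (by positivity) h1 hθ
      rw [hi, pow_succ]
      nlinarith
  have hx : |u x - u (y j)| ≤ (2 * C ^ s * R ^ s * (N * a)) * t ^ j := by
    calc |u x - u (y j)| ≤ ρ x (y j) ^ s * (g x + g (y j)) := hgrad _ hxS _ (hyS j)
      _ ≤ (C * (R * (1 / 2) ^ j)) ^ s * (N * a * τ ^ j + N * (a * τ ^ j)) := by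
        gcongr
        · exact add_nonneg (hg _) (hg _)
        · exact hρ _ _
        · exact hpair _ _ _ (by rw [hxx]; positivity) (hyρ j)
        · exact hyg j
      _ = ((C * (R * (1 / 2) ^ j)) ^ s * τ ^ j) * (2 * (N * a)) := by ring
      _ = _ := by rw [hpow]; ring
  have hD : 0 ≤ C ^ s := Real.rpow_nonneg hC _
  have hRs : 0 < R ^ s := Real.rpow_pos_of_pos hR _
  have htel := abs_le_of_geometric_steps (v := fun j => u (y j)) ht (by positivity) hstep j
  have hy0 : |u (y 0)| ≤ U * a := by simpa using hyu 0
  have habs : |u x| ≤ |u x - u (y j)| + |u (y j)| := by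
    have := abs_add_le (u x - u (y j)) (u (y j))
    simpa using this
  set A := C ^ s * (1 + τ) / (t - 1) + 2 * C ^ s with hA
  have hA0 : 0 ≤ A := by
    have : 0 < t - 1 := by linarith
    positivity
  set z := (g x / (N * a)) ^ θ
  have hAeq : C ^ s * R ^ s * (N * a) * (1 + τ) / (t - 1) * t ^ j +
      2 * C ^ s * R ^ s * (N * a) * t ^ j = A * R ^ s * (N * a) * t ^ j := by
    rw [hA]; ring
  have h4 : A * R ^ s * (N * a) * t ^ j ≤ A * R ^ s * (N * a) * (1 + t * z) := by gcongr
  have h5 : |u x| ≤ U * a + A * R ^ s * (N * a) * (1 + t * z) := by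
    linarith
  refine h5.trans ?_
  have h6 : (1 + A * (1 + t)) * a * (U + R ^ s * N) * (1 + z) -
      (U * a + A * R ^ s * (N * a) * (1 + t * z)) =
      U * a * z + a * (R ^ s * N) * (1 + z) + A * (1 + t) * a * U * (1 + z)
        + A * a * (R ^ s * N) * (z + t) := by ring
  have h7 : 0 ≤ U * a * z + a * (R ^ s * N) * (1 + z) + A * (1 + t) * a * U * (1 + z)
        + A * a * (R ^ s * N) * (z + t) := by positivity
  linarith

theorem iSup_le_lqN {q : ℝ≥0∞} (hq : 0 < q) (a : ℤ → ℝ≥0∞) : ⨆ k, a k ≤ lqN q a := by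
  unfold lqN
  split_ifs with h
  · exact le_rfl
  · have hq' : 0 < q.toReal := ENNReal.toReal_pos hq.ne' h
    refine iSup_le fun k => ?_
    calc a k = (a k ^ q.toReal) ^ (1 / q.toReal) := by
          rw [← ENNReal.rpow_mul, mul_one_div_cancel hq'.ne', ENNReal.rpow_one]
      _ ≤ _ := by
        gcongr
        exact ENNReal.le_tsum k

theorem lintegral_rpow_le_of_lpN_le {X : Type*} [MeasurableSpace X] {ν : Measure X} {p : ℝ}
    (hp : 0 < p) {f : X → ℝ≥0∞} {N : ℝ≥0∞} (h : lpN ν p f ≤ N) : ∫⁻ x, f x ^ p ∂ν ≤ N ^ p := by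
  have := ENNReal.rpow_le_rpow h hp.le
  rwa [lpN, ← ENNReal.rpow_mul, one_div_mul_cancel hp.ne', ENNReal.rpow_one] at this

theorem measure_le_of_lintegral_rpow_le {X : Type*} [MeasurableSpace X] {ν : Measure X}
    {p N A : ℝ} (hp : 0 < p) (hN : 0 < N) (hA : 0 < A) {f : X → ℝ≥0∞} (hf : AEMeasurable f ν)
    (h : ∫⁻ x, f x ^ p ∂ν ≤ ENNReal.ofReal N ^ p) :
    ν {x | ENNReal.ofReal (N * A) ≤ f x} ≤ ENNReal.ofReal ((A ^ p)⁻¹) := by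
  have hset : {x | ENNReal.ofReal (N * A) ≤ f x} =
      {x | ENNReal.ofReal (N * A) ^ p ≤ f x ^ p} := by
    ext x
    exact (ENNReal.rpow_le_rpow_iff hp).symm
  have h1 := (mul_meas_ge_le_lintegral₀ (hf.pow_const p) (ENNReal.ofReal (N * A) ^ p)).trans h
  rw [hset]
  have hNp : 0 < N ^ p := Real.rpow_pos_of_pos hN p
  have hAp : 0 < A ^ p := Real.rpow_pos_of_pos hA p
  rw [ENNReal.ofReal_rpow_of_pos (by positivity), ENNReal.ofReal_rpow_of_pos hN] at h1
  rw [ENNReal.ofReal_rpow_of_pos (by positivity)]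
  rw [mul_comm, ← ENNReal.le_div_iff_mul_le (Or.inl (by
    rw [Real.mul_rpow hN.le hA.le]; simp; positivity)) (Or.inl ENNReal.ofReal_ne_top)] at h1
  refine h1.trans (le_of_eq ?_)
  rw [Real.mul_rpow hN.le hA.le, ← ENNReal.ofReal_div_of_pos (by positivity)]
  congr 1
  field_simp

theorem exists_mem_lt_lt {X : Type*} [MeasurableSpace X] {ν : Measure X}
    {p N U A : ℝ} (hp : 0 < p) (hN : 0 < N) (hU : 0 < U) (hA : 0 < A) {f v : X → ℝ≥0∞}
    (hf : AEMeasurable f ν) (hv : AEMeasurable v ν)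
    (hfN : ∫⁻ x, f x ^ p ∂ν ≤ ENNReal.ofReal N ^ p)
    (hvU : ∫⁻ x, v x ^ p ∂ν ≤ ENNReal.ofReal U ^ p) {E B : Set X} (hE : ν E = 0)
    (hB : ENNReal.ofReal (4 * (A ^ p)⁻¹) ≤ ν B) :
    ∃ y ∈ B, y ∉ E ∧ f y < ENNReal.ofReal (N * A) ∧ v y < ENNReal.ofReal (U * A) := by
  by_contra! hcon
  have hsub : B ⊆ E ∪ ({x | ENNReal.ofReal (N * A) ≤ f x} ∪ {x | ENNReal.ofReal (U * A) ≤ v x}) := by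
    intro y hy
    by_cases h1 : y ∈ E
    · exact Or.inl h1
    · by_cases h2 : f y < ENNReal.ofReal (N * A)
      · exact Or.inr (Or.inr (hcon y hy h1 h2))
      · exact Or.inr (Or.inl (not_lt.1 h2))
  have hAp : 0 < (A ^ p)⁻¹ := inv_pos.2 (Real.rpow_pos_of_pos hA p)
  have : ν B ≤ ENNReal.ofReal (2 * (A ^ p)⁻¹) := by
    calc ν B ≤ ν E + (ν {x | ENNReal.ofReal (N * A) ≤ f x} +
          ν {x | ENNReal.ofReal (U * A) ≤ v x}) :=
          (measure_mono hsub).trans ((measure_union_le _ _).trans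
            (by gcongr; exact measure_union_le _ _))
      _ ≤ 0 + (ENNReal.ofReal ((A ^ p)⁻¹) + ENNReal.ofReal ((A ^ p)⁻¹)) := by
        gcongr
        · exact hE.le
        · exact measure_le_of_lintegral_rpow_le hp hN hA hf hfN
        · exact measure_le_of_lintegral_rpow_le hp hU hA hv hvU
      _ = _ := by rw [zero_add, ← ENNReal.ofReal_add hAp.le hAp.le]; ring_nf
  have h2 := hB.trans this
  rw [ENNReal.ofReal_le_ofReal_iff (by positivity)] at h2
  linarith

theorem abs_sub_le_of_fracGrad {X : Type*} {ρ : X → X → ℝ} {s : ℝ} {u : X → ℝ} {g : ℤ → X → ℝ}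
    {S : Set X} (hs : 0 < s) (hρ : ∀ x y, 0 ≤ ρ x y) (hρ0 : ∀ x y, ρ x y = 0 ↔ x = y)
    (hg : ∀ k : ℤ, ∀ x ∈ S, ∀ y ∈ S,
      (2 : ℝ) ^ (-k - 1) ≤ ρ x y → ρ x y < (2 : ℝ) ^ (-k) →
      |u x - u y| ≤ ρ x y ^ s * (g k x + g k y))
    {x y : X} (hx : x ∈ S) (hy : y ∈ S) (hfx : ⨆ k, ENNReal.ofReal (g k x) ≠ ∞)
    (hfy : ⨆ k, ENNReal.ofReal (g k y) ≠ ∞) :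
    |u x - u y| ≤ ρ x y ^ s *
      ((⨆ k, ENNReal.ofReal (g k x)).toReal + (⨆ k, ENNReal.ofReal (g k y)).toReal) := by
  by_cases hxy : x = y
  · subst hxy
    simp [(hρ0 x x).2 rfl, Real.zero_rpow hs.ne']
  · have hpos : 0 < ρ x y := lt_of_le_of_ne (hρ x y) (fun h => hxy ((hρ0 x y).1 h.symm))
    obtain ⟨n, hn1, hn2⟩ := exists_mem_Ico_zpow hpos (one_lt_two : (1 : ℝ) < 2)
    have hle : ∀ z, (⨆ k, ENNReal.ofReal (g k z)) ≠ ∞ →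
        g (-n - 1) z ≤ (⨆ k, ENNReal.ofReal (g k z)).toReal := fun z hz =>
      (ENNReal.ofReal_le_iff_le_toReal hz).1 (le_iSup (fun k => ENNReal.ofReal (g k z)) (-n - 1))
    refine (hg (-n - 1) x hx y hy ?_ ?_).trans ?_
    · rwa [show -(-n - 1) - 1 = n by ring]
    · rwa [show -(-n - 1) = n + 1 by ring]
    · gcongr
      · exact hle x hfx
      · exact hle y hfy

/-- In a `Q`-doubling space, a set with the measure density condition satisfies a relative lower
mass bound. -/
theorem exists_lower_mass_bound {X : Type*} [MeasurableSpace X] {ρ : X → X → ℝ} {μ : Measure X}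
    (hX : IsQMMS ρ μ) {Q : ℝ} (hdoub : QDoubling ρ μ Q) {Ω : Set X}
    (hdens : MeasDensity ρ μ Ω) :
    ∃ c : ℝ, 0 < c ∧ ∀ x₀, ∀ R : ℝ, 0 < R → R ≤ 1 → ∀ x ∈ qball ρ x₀ R ∩ Ω,
      ∀ δ : ℝ, 0 < δ → δ ≤ 1 →
        ENNReal.ofReal (c * (μ (qball ρ x₀ R)).toReal * δ ^ Q) ≤
          μ.restrict Ω (qball ρ x (R * δ)) := by
  obtain ⟨κ, hκ, hd⟩ := hdoub
  obtain ⟨c, hc, hdens⟩ := hdens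
  obtain ⟨-, -, -, C₁, hC₁, htri⟩ := hX.quasi
  have hC₁0 : 0 < C₁ := by linarith
  have hCQ : 0 < C₁ ^ Q := Real.rpow_pos_of_pos hC₁0 Q
  refine ⟨κ / C₁ ^ Q / c, by positivity, ?_⟩
  intro x₀ R hR hR1 x hx δ hδ hδ1
  have hr : 0 < R * δ := by positivity
  have hrR : R * δ ≤ R := by nlinarith
  have hRC : R ≤ C₁ * R := by nlinarith
  have hsub : qball ρ x (R * δ) ⊆ qball ρ x₀ (C₁ * R) := by
    intro y hy
    have hy' : ρ x y < R * δ := hy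
    have hx' : ρ x₀ x < R := hx.1
    exact (htri x₀ y x).trans_lt
      (mul_lt_mul_of_pos_left (max_lt hx' (hy'.trans_le hrR)) hC₁0)
  have h1 := hd x x₀ (R * δ) (C₁ * R) hr (hrR.trans hRC) hsub
  have h2 : μ (qball ρ x₀ R) ≤ μ (qball ρ x₀ (C₁ * R)) :=
    measure_mono fun y (hy : ρ x₀ y < R) => hy.trans_le hRC
  have h3 := hdens x hx.2 (R * δ) hr (hrR.trans hR1)
  rw [Measure.restrict_apply (hX.measurableSet_ball _ _ hr)]
  have hdiv : (R * δ / (C₁ * R)) ^ Q = δ ^ Q / C₁ ^ Q := by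
    rw [mul_comm C₁, mul_div_mul_left _ _ hR.ne', Real.div_rpow hδ.le hC₁0.le]
  rw [hdiv] at h1
  have h4 : ENNReal.ofReal (κ * (δ ^ Q / C₁ ^ Q)) * μ (qball ρ x₀ R) ≤
      ENNReal.ofReal c * μ (qball ρ x (R * δ) ∩ Ω) :=
    (by gcongr : _ ≤ _).trans (h1.trans h3)
  have hδQ : 0 < δ ^ Q := Real.rpow_pos_of_pos hδ Q
  have hfin : μ (qball ρ x₀ R) ≠ ∞ := (hX.ball_lt_top x₀ R hR).ne
  have h5 : ENNReal.ofReal (κ / C₁ ^ Q / c * (μ (qball ρ x₀ R)).toReal * δ ^ Q) =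
      (ENNReal.ofReal (κ * (δ ^ Q / C₁ ^ Q)) * μ (qball ρ x₀ R)) / ENNReal.ofReal c := by
    conv_rhs => rw [← ENNReal.ofReal_toReal hfin]
    rw [← ENNReal.ofReal_mul (by positivity), ← ENNReal.ofReal_div_of_pos hc]
    congr 1
    ring
  rw [h5]
  refine ENNReal.div_le_of_le_mul ?_
  rwa [mul_comm (μ _)]

theorem add_rpow_le_two_rpow_mul_s14 {x y P : ℝ} (hx : 0 ≤ x) (hy : 0 ≤ y) (hP : 0 < P) :
    (x + y) ^ P ≤ 2 ^ P * (x ^ P + y ^ P) := by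
  have hx' := Real.rpow_nonneg hx P
  have hy' := Real.rpow_nonneg hy P
  rcases le_total x y with h | h
  · calc (x + y) ^ P ≤ (2 * y) ^ P := by gcongr; linarith
      _ = 2 ^ P * y ^ P := Real.mul_rpow (by norm_num) hy
      _ ≤ _ := by gcongr; linarith
  · calc (x + y) ^ P ≤ (2 * x) ^ P := by gcongr; linarith
      _ = 2 ^ P * x ^ P := Real.mul_rpow (by norm_num) hx
      _ ≤ _ := by gcongr; linarith

/-- The local embedding estimate with the two norms replaced by strictly larger positive reals. -/
theorem exists_lpOn_le_of_MdotNorm_lt {X : Type*} [MeasurableSpace X] {ρ : X → X → ℝ}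
    {μ : Measure X} (hX : IsQMMS ρ μ) {Q : ℝ} (hQ : 0 < Q) (hdoub : QDoubling ρ μ Q)
    {Ω : Set X} (hΩ : MeasurableSet Ω) (hdens : MeasDensity ρ μ Ω) {s p : ℝ} {q : ℝ≥0∞}
    (hs : 0 < s) (hp : 0 < p) (hpQ : p < Q / s) (hq : 0 < q) :
    ∃ CS : ℝ, 0 < CS ∧ ∀ x₀ : X, ∀ R : ℝ, 0 < R → R ≤ 1 → ∀ u : X → ℝ,
      AEMeasurable u (μ.restrict Ω) → ∀ N U : ℝ, 0 < N → 0 < U →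
      MdotNorm ρ μ Ω s p q u < ENNReal.ofReal N → lpOn μ Ω p u ≤ ENNReal.ofReal U →
      lpOn μ (qball ρ x₀ R ∩ Ω) (Q * p / (Q - s * p)) u ≤
        (ENNReal.ofReal CS / μ (qball ρ x₀ R) ^ (s / Q)) *
          (ENNReal.ofReal (R ^ s) * ENNReal.ofReal N + ENNReal.ofReal U) := by
  obtain ⟨hρ, hρ0, ⟨C₀, hC₀, hsymm⟩, C₁, hC₁, htri⟩ := hX.quasi
  obtain ⟨c, hc, hmass⟩ := exists_lower_mass_bound hX hdoub hdens
  have hsp : s * p < Q := by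
    rw [lt_div_iff₀ hs] at hpQ
    linarith
  set P := Q * p / (Q - s * p) with hPdef
  have hQsp : 0 < Q - s * p := by linarith
  have hP : 0 < P := by positivity
  set τ : ℝ := 2 ^ (Q / p) with hτdef
  set θ : ℝ := 1 - s * p / Q with hθdef
  set t : ℝ := τ ^ θ with htdef
  have hτ : 1 < τ := Real.one_lt_rpow (by norm_num) (by positivity)
  have hθ : 0 < θ := by
    rw [hθdef, sub_pos, div_lt_one hQ]
    exact hsp
  have hθP : θ * P = p := by
    rw [hθdef, hPdef]
    field_simp
  have ht : 1 < t := Real.one_lt_rpow hτ hθ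
  have htτ : t = (1 / 2 : ℝ) ^ s * τ := by
    rw [htdef, hτdef, ← Real.rpow_mul (by norm_num), one_div, Real.inv_rpow (by norm_num),
      ← Real.rpow_neg (by norm_num), ← Real.rpow_add (by norm_num)]
    congr 1
    rw [hθdef]
    field_simp
    ring
  have hτp : τ ^ p = 2 ^ Q := by
    rw [hτdef, ← Real.rpow_mul (by norm_num), div_mul_cancel₀ _ hp.ne']
  set C := C₁ * C₀ with hC
  have hC0 : 0 < C := by positivity
  set K := 1 + (C ^ s * (1 + τ) / (t - 1) + 2 * C ^ s) * (1 + t)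
  have hKpos : 0 < K := by
    have : 0 < t - 1 := by linarith
    positivity
  refine ⟨2 * K * (4 / c) ^ (1 / p) * (1 + c / 4) ^ (1 / P), by positivity, ?_⟩
  intro x₀ R hR hR1 u hu N U hN hU hNu hUu
  set V := (μ (qball ρ x₀ R)).toReal
  have hVfin : μ (qball ρ x₀ R) ≠ ∞ := (hX.ball_lt_top x₀ R hR).ne
  have hV : 0 < V := ENNReal.toReal_pos (hX.ball_pos x₀ R hR).ne' hVfin
  have hVeq : μ (qball ρ x₀ R) = ENNReal.ofReal V := (ENNReal.ofReal_toReal hVfin).symm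
  set a : ℝ := (4 / (c * V)) ^ (1 / p) with hadef
  have ha : 0 < a := by positivity
  have hap : a ^ p = 4 / (c * V) := by
    rw [hadef, ← Real.rpow_mul (by positivity), one_div_mul_cancel hp.ne', Real.rpow_one]
  obtain ⟨g, hg, hgN⟩ : ∃ g ∈ fracGrad ρ μ Ω s u,
      lpN (μ.restrict Ω) p (fun x => lqN q fun k => ENNReal.ofReal (g k x)) <
        ENNReal.ofReal N := by
    simpa only [MdotNorm, iInf_lt_iff, exists_prop] using hNu
  obtain ⟨-, hgm, E, hE, hgE⟩ := hg
  set h : X → ℝ≥0∞ := fun x => ⨆ k, ENNReal.ofReal (g k x) with hh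
  have hhm : AEMeasurable h (μ.restrict Ω) := AEMeasurable.iSup fun k => (hgm k).ennreal_ofReal
  have hhN : ∫⁻ x, h x ^ p ∂μ.restrict Ω ≤ ENNReal.ofReal N ^ p :=
    (lintegral_mono fun x => ENNReal.rpow_le_rpow (iSup_le_lqN hq _) hp.le).trans
      (lintegral_rpow_le_of_lpN_le hp hgN.le)
  have huU : ∫⁻ x, ENNReal.ofReal |u x| ^ p ∂μ.restrict Ω ≤ ENNReal.ofReal U ^ p :=
    lintegral_rpow_le_of_lpN_le hp hUu
  have hum : AEMeasurable (fun x => ENNReal.ofReal |u x|) (μ.restrict Ω) :=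
    (continuous_abs.measurable.comp_aemeasurable hu).ennreal_ofReal
  have hhfin : ∀ᵐ x ∂μ.restrict Ω, h x ≠ ∞ := by
    have := ae_lt_top' (hhm.pow_const p)
      (hhN.trans_lt (ENNReal.rpow_lt_top_of_nonneg hp.le ENNReal.ofReal_ne_top)).ne
    filter_upwards [this] with x hx hx'
    rw [hx', ENNReal.top_rpow_of_pos hp] at hx
    exact lt_irrefl _ hx
  set S : Set X := {x | x ∈ Ω ∧ x ∉ E ∧ h x ≠ ∞} with hS
  have hSae : ∀ᵐ x ∂μ.restrict Ω, x ∈ S := by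
    have hE' : ∀ᵐ x ∂μ.restrict Ω, x ∉ E :=
      ae_restrict_of_ae (measure_eq_zero_iff_ae_notMem.1 hE)
    filter_upwards [hhfin, hE', ae_restrict_mem hΩ] with x h1 h2 h3 using ⟨h3, h2, h1⟩
  have hgrad : ∀ y ∈ S, ∀ z ∈ S,
      |u y - u z| ≤ ρ y z ^ s * ((h y).toReal + (h z).toReal) := fun y hy z hz =>
    abs_sub_le_of_fracGrad (S := Ω \ E) hs hρ hρ0 hgE ⟨hy.1, hy.2.1⟩ ⟨hz.1, hz.2.1⟩ hy.2.2 hz.2.2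
  have hpts : ∀ x ∈ qball ρ x₀ R ∩ Ω, ∀ j : ℕ, ∃ y ∈ S, ρ x y < R * (1 / 2) ^ j ∧
      (h y).toReal ≤ N * (a * τ ^ j) ∧ |u y| ≤ U * (a * τ ^ j) := by
    intro x hx j
    have hA : 0 < a * τ ^ j := by positivity
    have hmassj := hmass x₀ R hR hR1 x hx ((1 / 2) ^ j) (by positivity)
      (pow_le_one₀ (by norm_num) (by norm_num))
    have heq : 4 * ((a * τ ^ j) ^ p)⁻¹ = c * V * ((1 / 2 : ℝ) ^ j) ^ Q := by
      rw [Real.mul_rpow ha.le (by positivity), hap, ← Real.rpow_pow_comm (by positivity), hτp,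
        ← Real.rpow_pow_comm (by norm_num), one_div, Real.inv_rpow (by norm_num), inv_pow]
      field_simp
    rw [← heq] at hmassj
    obtain ⟨y, hyB, hyS, hyh, hyu⟩ := exists_mem_lt_lt hp hN hU hA hhm hum hhN huU
      (E := Sᶜ) hSae hmassj
    exact ⟨y, not_not.1 hyS, hyB, (ENNReal.toReal_lt_of_lt_ofReal hyh).le,
      ((ENNReal.ofReal_lt_ofReal_iff (by positivity)).1 hyu).le⟩
  set M := K * a * (U + R ^ s * N) with hM
  have hMpos : 0 < M := by positivity
  have hNa : 0 < N * a := by positivity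
  have hpoint : ∀ x ∈ qball ρ x₀ R ∩ Ω, x ∈ S → ENNReal.ofReal |u x| ^ P ≤
      ENNReal.ofReal ((2 * M) ^ P) * (1 + ENNReal.ofReal (((N * a) ^ p)⁻¹) * h x ^ p) := by
    intro x hx hxS
    have hb := abs_le_of_controlled_points (g := fun x => (h x).toReal) hs hC0.le hR ha hN hU
      hτ ht hθ.le htτ htdef hxS hρ ((hρ0 x x).2 rfl) (fun y => ENNReal.toReal_nonneg) hgrad
      (fun y z r hy hz => by
        have hr : 0 ≤ r := (hρ x y).trans hy.le
        have h1 : ρ y x ≤ C₀ * r := (hsymm x y).trans (by gcongr)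
        have h2 : ρ x z ≤ C₀ * r := hz.le.trans (by nlinarith)
        calc ρ y z ≤ C₁ * max (ρ y x) (ρ x z) := htri y z x
          _ ≤ C₁ * (C₀ * r) := by gcongr; exact max_le h1 h2
          _ = C * r := by rw [hC]; ring) (hpts x hx)
    set w := (h x).toReal with hw
    have hw0 : 0 ≤ w := ENNReal.toReal_nonneg
    have hz0 : 0 ≤ w / (N * a) := by positivity
    have hreal : |u x| ^ P ≤ (2 * M) ^ P * (1 + ((N * a) ^ p)⁻¹ * w ^ p) := by
      calc |u x| ^ P ≤ (M * (1 + (w / (N * a)) ^ θ)) ^ P := by gcongr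
        _ = M ^ P * (1 + (w / (N * a)) ^ θ) ^ P := Real.mul_rpow hMpos.le (by positivity)
        _ ≤ M ^ P * (2 ^ P * (1 ^ P + ((w / (N * a)) ^ θ) ^ P)) := by
          gcongr
          exact add_rpow_le_two_rpow_mul_s14 zero_le_one (by positivity) hP
        _ = _ := by
          rw [Real.one_rpow, ← Real.rpow_mul hz0, hθP, Real.div_rpow hw0 hNa.le,
            Real.mul_rpow (by norm_num) hMpos.le]
          ring
    have hhx : h x ^ p = ENNReal.ofReal (w ^ p) := by
      rw [← ENNReal.ofReal_rpow_of_nonneg hw0 hp.le, hw, ENNReal.ofReal_toReal hxS.2.2]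
    rw [hhx, ENNReal.ofReal_rpow_of_nonneg (abs_nonneg _) hP.le,
      ← ENNReal.ofReal_mul (by positivity), ← ENNReal.ofReal_one,
      ← ENNReal.ofReal_add zero_le_one (by positivity), ← ENNReal.ofReal_mul (by positivity)]
    exact ENNReal.ofReal_le_ofReal hreal
  have hBΩ : MeasurableSet (qball ρ x₀ R ∩ Ω) := (hX.measurableSet_ball x₀ R hR).inter hΩ
  have hle : μ.restrict (qball ρ x₀ R ∩ Ω) ≤ μ.restrict Ω :=
    Measure.restrict_mono inter_subset_right le_rfl
  have hint : ∫⁻ x, ENNReal.ofReal |u x| ^ P ∂μ.restrict (qball ρ x₀ R ∩ Ω) ≤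
      ENNReal.ofReal ((2 * M) ^ P * (V * (1 + c / 4))) := by
    calc ∫⁻ x, ENNReal.ofReal |u x| ^ P ∂μ.restrict (qball ρ x₀ R ∩ Ω)
        ≤ ∫⁻ x, ENNReal.ofReal ((2 * M) ^ P) * (1 + ENNReal.ofReal (((N * a) ^ p)⁻¹) * h x ^ p)
            ∂μ.restrict (qball ρ x₀ R ∩ Ω) := by
          refine lintegral_mono_ae ?_
          filter_upwards [ae_restrict_mem hBΩ, ae_mono hle hSae] with x h1 h2
          exact hpoint x h1 h2
      _ = ENNReal.ofReal ((2 * M) ^ P) * (μ (qball ρ x₀ R ∩ Ω) +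
            ENNReal.ofReal (((N * a) ^ p)⁻¹) *
              ∫⁻ x, h x ^ p ∂μ.restrict (qball ρ x₀ R ∩ Ω)) := by
          rw [lintegral_const_mul' _ _ ENNReal.ofReal_ne_top, lintegral_add_left measurable_const,
            lintegral_const_mul' _ _ ENNReal.ofReal_ne_top]
          simp
      _ ≤ ENNReal.ofReal ((2 * M) ^ P) * (ENNReal.ofReal V +
            ENNReal.ofReal (((N * a) ^ p)⁻¹) * ENNReal.ofReal N ^ p) := by
          gcongr
          · exact hVeq ▸ measure_mono inter_subset_left
          · exact (lintegral_mono' hle le_rfl).trans hhN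
      _ = _ := by
          rw [ENNReal.ofReal_rpow_of_pos hN, ← ENNReal.ofReal_mul (by positivity),
            ← ENNReal.ofReal_add hV.le (by positivity), ← ENNReal.ofReal_mul (by positivity)]
          congr 2
          rw [Real.mul_rpow hN.le ha.le, hap]
          have : 0 < N ^ p := by positivity
          field_simp
  have hroot : lpOn μ (qball ρ x₀ R ∩ Ω) P u ≤
      ENNReal.ofReal (((2 * M) ^ P * (V * (1 + c / 4))) ^ (1 / P)) := by
    rw [← ENNReal.ofReal_rpow_of_nonneg (by positivity) (by positivity)]
    exact ENNReal.rpow_le_rpow hint (by positivity)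
  refine hroot.trans (le_of_eq ?_)
  rw [hVeq, ENNReal.ofReal_rpow_of_pos hV, ← ENNReal.ofReal_div_of_pos (by positivity),
    ← ENNReal.ofReal_mul (by positivity), ← ENNReal.ofReal_add (by positivity) hU.le,
    ← ENNReal.ofReal_mul (by positivity)]
  congr 1
  have hexp : 1 / P + s / Q = 1 / p := by
    rw [hPdef]
    field_simp
    ring
  have hVexp : V ^ (1 / p) = V ^ (1 / P) * V ^ (s / Q) := by
    rw [← Real.rpow_add hV, hexp]
  have haV : a = (4 / c) ^ (1 / p) / V ^ (1 / p) := by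
    rw [hadef, ← div_div, Real.div_rpow (by positivity) hV.le]
  rw [Real.mul_rpow (by positivity) (by positivity), ← Real.rpow_mul (by positivity),
    mul_one_div_cancel hP.ne', Real.rpow_one, Real.mul_rpow hV.le (by positivity), hM, haV, hVexp]
  have h1 : 0 < V ^ (1 / P) := by positivity
  have h2 : 0 < V ^ (s / Q) := by positivity
  field_simp
  ring

/-- Theorem 4.4 ((a) ⟹ (d)): the measure density condition implies a local
Sobolev-type embedding for `Ṁ^s_{p,q}(Ω)` for all `s ∈ (0,∞)`, `p ∈ (0,Q/s)`,
`q ∈ (0,∞]`. -/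
theorem measure_density_implies_M_embedding
    {X : Type*} [MeasurableSpace X] (ρ : X → X → ℝ) (μ : Measure X)
    (hX : IsQMMS ρ μ) (Q : ℝ) (hQ : 0 < Q) (hdoub : QDoubling ρ μ Q)
    (Ω : Set X) (hΩmeas : MeasurableSet Ω) (hΩne : Ω.Nonempty)
    (hdens : MeasDensity ρ μ Ω) :
    ∀ (s p : ℝ) (q : ℝ≥0∞), 0 < s → 0 < p → p < Q / s → 0 < q →
      ∃ CS : ℝ, 0 < CS ∧ ∀ x₀ ∈ Ω, ∀ R₀ : ℝ, 0 < R₀ → R₀ ≤ 1 →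
        ∀ u : X → ℝ, AEMeasurable u (μ.restrict Ω) → MdotNorm ρ μ Ω s p q u ≠ ∞ →
          lpOn μ (qball ρ x₀ R₀ ∩ Ω) (Q * p / (Q - s * p)) u ≤
            (ENNReal.ofReal CS / μ (qball ρ x₀ R₀) ^ (s / Q)) *
              (ENNReal.ofReal (R₀ ^ s) * MdotNorm ρ μ Ω s p q u + lpOn μ Ω p u) := by
  intro s p q hs hp hpQ hq
  obtain ⟨CS, hCS, hmain⟩ := exists_lpOn_le_of_MdotNorm_lt hX hQ hdoub hΩmeas hdens hs hp hpQ hq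
  refine ⟨CS, hCS, fun x₀ _ R hR hR1 u hu hM => ?_⟩
  have hB0 : μ (qball ρ x₀ R) ≠ 0 := (hX.ball_pos x₀ R hR).ne'
  have hBfin : μ (qball ρ x₀ R) ≠ ∞ := (hX.ball_lt_top x₀ R hR).ne
  have hB1 : μ (qball ρ x₀ R) ^ (s / Q) ≠ 0 := by
    simp [hB0, hBfin]
  have hB2 : μ (qball ρ x₀ R) ^ (s / Q) ≠ ∞ :=
    ENNReal.rpow_ne_top_of_nonneg (by positivity) hBfin
  set F := ENNReal.ofReal CS / μ (qball ρ x₀ R) ^ (s / Q) with hF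
  have hF0 : F ≠ 0 := by
    simp [hF, ENNReal.div_eq_zero_iff, hB2, hCS]
  have hFtop : F ≠ ∞ := ENNReal.div_ne_top ENNReal.ofReal_ne_top hB1
  by_cases hL : lpOn μ Ω p u = ∞
  · rw [hL, add_top, ENNReal.mul_top hF0]
    exact le_top
  set m := MdotNorm ρ μ Ω s p q u
  set l := lpOn μ Ω p u
  have hbound : ∀ ε : ℝ, 0 < ε → lpOn μ (qball ρ x₀ R ∩ Ω) (Q * p / (Q - s * p)) u ≤
      F * (ENNReal.ofReal (R ^ s) * (m + ENNReal.ofReal ε) + (l + ENNReal.ofReal ε)) := by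
    intro ε hε
    have hadd : ∀ b : ℝ≥0∞, b ≠ ∞ →
        ENNReal.ofReal (b.toReal + ε) = b + ENNReal.ofReal ε := fun b hb => by
      rw [ENNReal.ofReal_add ENNReal.toReal_nonneg hε.le, ENNReal.ofReal_toReal hb]
    have := hmain x₀ R hR hR1 u hu (m.toReal + ε) (l.toReal + ε)
      (add_pos_of_nonneg_of_pos ENNReal.toReal_nonneg hε)
      (add_pos_of_nonneg_of_pos ENNReal.toReal_nonneg hε)
      (by rw [hadd m hM]; exact ENNReal.lt_add_right hM (by simpa using hε))
      (by rw [hadd l hL]; exact le_self_add)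
    rwa [hadd m hM, hadd l hL] at this
  have hε : Filter.Tendsto (fun ε : ℝ => ENNReal.ofReal ε) (nhdsWithin 0 (Ioi 0)) (nhds 0) := by
    have := (ENNReal.continuous_ofReal.tendsto 0).mono_left
      (nhdsWithin_le_nhds (a := (0 : ℝ)) (s := Ioi 0))
    rwa [ENNReal.ofReal_zero] at this
  have hlim : Filter.Tendsto
      (fun ε : ℝ => F * (ENNReal.ofReal (R ^ s) * (m + ENNReal.ofReal ε) + (l + ENNReal.ofReal ε)))
      (nhdsWithin 0 (Ioi 0)) (nhds (F * (ENNReal.ofReal (R ^ s) * (m + 0) + (l + 0)))) :=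
    ENNReal.Tendsto.const_mul
      ((ENNReal.Tendsto.const_mul (tendsto_const_nhds.add hε) (Or.inr ENNReal.ofReal_ne_top)).add
        (tendsto_const_nhds.add hε)) (Or.inr hFtop)
  rw [add_zero, add_zero] at hlim
  exact ge_of_tendsto hlim (Filter.eventually_of_mem self_mem_nhdsWithin hbound)

end HajlaszPaper
end
end
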